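/- arXiv:1706.07741 — 2 statements merged into one kernel-verified Lean document; each statement's English description precedes it below -/
import Mathlib

section
/- Let x₀, x₁, …, x_N ∈ ℝ², let β be a multi-index in two variables with |β| = 2, and let a₁, …, a_N be real numbers solving the linear system Σ_{i=1}^{N} a_i (x_i − x₀)^α / α! = 1 if α = β and = 0 otherwise, for every multi-index α with 1 ≤ |α| ≤ 3. Let K ⊆ ℝ² be a convex set containing x₀, x₁, …, x_N, and let u: ℝ² → ℝ be four times continuously differentiable with the operator norm of its fourth Fréchet derivative bounded by M₄ on K. Then |Σ_{i=1}^{N} a_i (u(x_i) − u(x₀)) − ∂^β u(x₀)| ≤ (M₄/24) · Σ_{i=1}^{N} |a_i| ‖x_i − x₀‖⁴; in particular, if ‖x_i − x₀‖ = O(h) for all i and Σ|a_i| = O(h^{-2}), the scheme is second-order accurate. -/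
open Finset

/-- Expansion of a multilinear map on the diagonal of the plane in coordinate directions. -/
theorem ContinuousMultilinearMap.apply_diagonal_eq_sum_piecewise {k : ℕ}
    (f : ContinuousMultilinearMap ℝ (fun _ : Fin k => ℝ × ℝ) ℝ) (y : ℝ × ℝ) :
    f (fun _ => y) = ∑ s : Finset (Fin k), y.1 ^ #s * y.2 ^ (k - #s) *
      f (s.piecewise (fun _ => (1, 0)) (fun _ => (0, 1))) := by
  have hy : (fun _ : Fin k => y) =
      (fun _ => y.1 • ((1 : ℝ), (0 : ℝ))) + (fun _ => y.2 • ((0 : ℝ), (1 : ℝ))) := by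
    funext; ext <;> simp
  rw [hy, f.map_add_univ]
  refine sum_congr rfl fun s _ => ?_
  have hs : s.piecewise (fun _ => y.1 • ((1 : ℝ), (0 : ℝ))) (fun _ => y.2 • ((0 : ℝ), (1 : ℝ))) =
      fun i => s.piecewise (fun _ => y.1) (fun _ => y.2) i •
        s.piecewise (fun _ => ((1 : ℝ), (0 : ℝ))) (fun _ => (0, 1)) i := by
    funext i
    by_cases hi : i ∈ s <;> simp [hi]
  rw [hs, f.map_smul_univ, prod_piecewise]
  simp [← compl_eq_univ_sdiff, card_compl]

/-- A weighted sum of diagonal values depends only on the moments of the weights. -/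
theorem ContinuousMultilinearMap.sum_mul_apply_diagonal {ι : Type*} [Fintype ι] {k : ℕ}
    (f : ContinuousMultilinearMap ℝ (fun _ : Fin k => ℝ × ℝ) ℝ) (a : ι → ℝ) (y : ι → ℝ × ℝ) :
    ∑ i, a i * f (fun _ => y i) = ∑ s : Finset (Fin k),
      (∑ i, a i * ((y i).1 ^ #s * (y i).2 ^ (k - #s))) *
        f (s.piecewise (fun _ => (1, 0)) (fun _ => (0, 1))) := by
  simp_rw [f.apply_diagonal_eq_sum_piecewise, mul_sum, sum_mul]
  rw [sum_comm]
  simp_rw [mul_assoc]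

/-- Third-order Taylor expansion with remainder controlled by the fourth derivative along the
segment. -/
theorem abs_sub_taylor_three_le {E : Type*} [NormedAddCommGroup E] [NormedSpace ℝ E]
    {u : E → ℝ} (hu : ContDiff ℝ 4 u) {x y : E} {M : ℝ}
    (hM : ∀ t ∈ Set.Icc (0 : ℝ) 1, ‖iteratedFDeriv ℝ 4 u (x + t • y)‖ ≤ M) :
    |u (x + y) - u x - iteratedFDeriv ℝ 1 u x (fun _ => y)
      - 1 / 2 * iteratedFDeriv ℝ 2 u x (fun _ => y)
      - 1 / 6 * iteratedFDeriv ℝ 3 u x (fun _ => y)| ≤ M / 24 * ‖y‖ ^ 4 := by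
  have h := map_add_eq_sum_add_integral_iteratedFDeriv (f := u) (x := x) (y := y) (n := 3)
    (fun t _ => by norm_num; exact hu.contDiffAt)
  have hR : ‖∫ t in (0 : ℝ)..1, (1 - t) ^ 3 • iteratedFDeriv ℝ (3 + 1) u (x + t • y) (fun _ => y)‖
      ≤ ∫ t in (0 : ℝ)..1, (1 - t) ^ 3 * (M * ‖y‖ ^ 4) := by
    refine intervalIntegral.norm_integral_le_of_norm_le zero_le_one ?_
      (Continuous.intervalIntegrable (by fun_prop) _ _)
    refine Filter.Eventually.of_forall fun t ht => ?_
    have ht0 : 0 ≤ (1 - t) ^ 3 := pow_nonneg (by linarith [ht.2]) 3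
    rw [norm_smul, Real.norm_of_nonneg ht0]
    gcongr
    refine (ContinuousMultilinearMap.le_opNorm _ _).trans ?_
    simp only [prod_const, card_univ, Fintype.card_fin]
    gcongr
    exact hM t ⟨ht.1.le, ht.2⟩
  have hI : ∫ t in (0 : ℝ)..1, (1 - t) ^ 3 * (M * ‖y‖ ^ 4) = M * ‖y‖ ^ 4 / 4 := by
    rw [intervalIntegral.integral_mul_const,
      intervalIntegral.integral_comp_sub_left (fun t : ℝ => t ^ 3) 1, integral_pow]
    norm_num
    ring
  rw [hI, Real.norm_eq_abs, abs_le] at hR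
  rw [h, abs_le]
  simp only [sum_range_succ, sum_range_zero, Nat.factorial, iteratedFDeriv_zero_apply,
    smul_eq_mul] at hR ⊢
  norm_num at hR ⊢
  constructor <;> linarith [hR.1, hR.2]

/-- A weighted sum of second-order diagonal values of a symmetric bilinear map on the plane equals
twice a coordinate value when `β` is the only index of order two with nonzero moment. -/
theorem sum_mul_apply_diagonal_two {ι : Type*} [Fintype ι]
    (f : ContinuousMultilinearMap ℝ (fun _ : Fin 2 => ℝ × ℝ) ℝ)
    (hf : ∀ v w, f ![v, w] = f ![w, v]) (a : ι → ℝ) (y : ι → ℝ × ℝ)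
    {β : ℕ × ℕ} (hβ : β.1 + β.2 = 2)
    (hmom : ∀ p q : ℕ, p + q = 2 → ∑ i, a i * ((y i).1 ^ p * (y i).2 ^ q) =
      if (p, q) = β then ((p.factorial * q.factorial : ℕ) : ℝ) else 0) :
    ∑ i, a i * f (fun _ => y i) =
      2 * f (fun k => if (k : ℕ) < β.1 then ((1 : ℝ), (0 : ℝ)) else (0, 1)) := by
  have hsum : ∀ i, a i * f (fun _ => y i) =
      a i * ((y i).1 ^ 2 * (y i).2 ^ 0) * f ![(1, 0), (1, 0)]
      + a i * ((y i).1 ^ 1 * (y i).2 ^ 1) * (f ![(1, 0), (0, 1)] + f ![(0, 1), (1, 0)])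
      + a i * ((y i).1 ^ 0 * (y i).2 ^ 2) * f ![(0, 1), (0, 1)] := by
    intro i
    have huniv : (univ : Finset (Finset (Fin 2))) = {∅, {0}, {1}, {0, 1}} := by decide
    have h0 : (∅ : Finset (Fin 2)).piecewise (fun _ => ((1 : ℝ), (0 : ℝ))) (fun _ => (0, 1)) =
        ![(0, 1), (0, 1)] := by
      funext j; fin_cases j <;> simp
    have h1 : ({0} : Finset (Fin 2)).piecewise (fun _ => ((1 : ℝ), (0 : ℝ))) (fun _ => (0, 1)) =
        ![(1, 0), (0, 1)] := by
      funext j; fin_cases j <;> simp [piecewise]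
    have h2 : ({1} : Finset (Fin 2)).piecewise (fun _ => ((1 : ℝ), (0 : ℝ))) (fun _ => (0, 1)) =
        ![(0, 1), (1, 0)] := by
      funext j; fin_cases j <;> simp [piecewise]
    have h3 : ({0, 1} : Finset (Fin 2)).piecewise (fun _ => ((1 : ℝ), (0 : ℝ))) (fun _ => (0, 1)) =
        ![(1, 0), (1, 0)] := by
      funext j; fin_cases j <;> simp [piecewise]
    rw [f.apply_diagonal_eq_sum_piecewise, huniv, sum_insert (by decide), sum_insert (by decide),
      sum_insert (by decide), sum_singleton, h0, h1, h2, h3]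
    simp
    ring
  have hvec : (fun k : Fin 2 => if (k : ℕ) < β.1 then ((1 : ℝ), (0 : ℝ)) else (0, 1)) =
      ![if 0 < β.1 then (1, 0) else (0, 1), if 1 < β.1 then (1, 0) else (0, 1)] := by
    funext j; fin_cases j <;> simp
  simp_rw [hsum, sum_add_distrib, ← sum_mul]
  rw [hmom 2 0 rfl, hmom 1 1 rfl, hmom 0 2 rfl, hf (0, 1) (1, 0), hvec]
  obtain ⟨p, q⟩ := β
  obtain ⟨rfl, rfl⟩ | ⟨rfl, rfl⟩ | ⟨rfl, rfl⟩ :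
      (p = 0 ∧ q = 2) ∨ (p = 1 ∧ q = 1) ∨ (p = 2 ∧ q = 0) := by
    simp only at hβ
    omega
  all_goals simp [two_mul]

/-- Error estimate for the least-squares generalised finite
difference approximation of the second partial derivative `∂^β u(x₀)`
(`|β| = 2`) built from the third-order Taylor consistency system. -/
theorem gfd_least_squares_error
    (N : ℕ) (x₀ : ℝ × ℝ) (x : Fin N → ℝ × ℝ) (a : Fin N → ℝ)
    (β : ℕ × ℕ) (hβ : β.1 + β.2 = 2)
    (hsys : ∀ α : ℕ × ℕ, 1 ≤ α.1 + α.2 → α.1 + α.2 ≤ 3 →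
      ∑ i, a i * ((x i - x₀).1^α.1 * (x i - x₀).2^α.2)
        / ((α.1.factorial * α.2.factorial : ℕ) : ℝ)
      = if α = β then 1 else 0)
    (K : Set (ℝ × ℝ)) (hK : Convex ℝ K)
    (hx₀ : x₀ ∈ K) (hx : ∀ i, x i ∈ K)
    (u : ℝ × ℝ → ℝ) (hu : ContDiff ℝ 4 u)
    (M₄ : ℝ) (hM₄ : ∀ p ∈ K, ‖iteratedFDeriv ℝ 4 u p‖ ≤ M₄) :
    |∑ i, a i * (u (x i) - u x₀)
      - iteratedFDeriv ℝ 2 u x₀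
          (fun k => if (k : ℕ) < β.1 then ((1:ℝ), (0:ℝ)) else (0, 1))|
    ≤ M₄ / 24 * ∑ i, |a i| * ‖x i - x₀‖^4 := by
  set y : Fin N → ℝ × ℝ := fun i => x i - x₀ with hy
  have hmom : ∀ p q : ℕ, 1 ≤ p + q → p + q ≤ 3 → ∑ i, a i * ((y i).1 ^ p * (y i).2 ^ q) =
      if (p, q) = β then ((p.factorial * q.factorial : ℕ) : ℝ) else 0 := by
    intro p q h1 h3
    have h := hsys (p, q) h1 h3
    have hne : ((p.factorial * q.factorial : ℕ) : ℝ) ≠ 0 := by positivity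
    rw [← sum_div, div_eq_iff hne] at h
    rw [h]
    split_ifs <;> simp
  have hodd : ∀ k, 1 ≤ k → k ≤ 3 → k ≠ 2 →
      ∑ i, a i * iteratedFDeriv ℝ k u x₀ (fun _ => y i) = 0 := by
    intro k h1 h3 h2
    rw [ContinuousMultilinearMap.sum_mul_apply_diagonal]
    refine sum_eq_zero fun s _ => ?_
    have hs : #s ≤ k := by simpa using card_le_univ s
    rw [hmom _ _ (by omega) (by omega), if_neg, zero_mul]
    rintro rfl
    simp only at hβ
    omega
  have hsymm : ∀ v w, iteratedFDeriv ℝ 2 u x₀ ![v, w] = iteratedFDeriv ℝ 2 u x₀ ![w, v] := by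
    intro v w
    have h := (hu.contDiffAt (x := x₀)).isSymmSndFDerivAt (by norm_num) v w
    simpa [iteratedFDeriv_two_apply] using h
  have htwo := sum_mul_apply_diagonal_two _ hsymm a y hβ
    fun p q hpq => hmom p q (by omega) (by omega)
  have hbound : ∀ i, |u (x i) - u x₀ - iteratedFDeriv ℝ 1 u x₀ (fun _ => y i)
      - 1 / 2 * iteratedFDeriv ℝ 2 u x₀ (fun _ => y i)
      - 1 / 6 * iteratedFDeriv ℝ 3 u x₀ (fun _ => y i)| ≤ M₄ / 24 * ‖x i - x₀‖ ^ 4 := by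
    intro i
    have h := abs_sub_taylor_three_le hu (x := x₀) (y := y i)
      fun t ht => hM₄ _ (hK.add_smul_sub_mem hx₀ (hx i) ht)
    simpa [hy] using h
  have hexp : ∑ i, a i * (u (x i) - u x₀) - iteratedFDeriv ℝ 2 u x₀
        (fun k => if (k : ℕ) < β.1 then ((1 : ℝ), (0 : ℝ)) else (0, 1)) =
      ∑ i, a i * (u (x i) - u x₀ - iteratedFDeriv ℝ 1 u x₀ (fun _ => y i)
        - 1 / 2 * iteratedFDeriv ℝ 2 u x₀ (fun _ => y i)
        - 1 / 6 * iteratedFDeriv ℝ 3 u x₀ (fun _ => y i)) := by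
    have h1 := hodd 1 le_rfl (by norm_num) (by norm_num)
    have h3 := hodd 3 (by norm_num) le_rfl (by norm_num)
    simp_rw [mul_sub, sum_sub_distrib, mul_left_comm (a _) (_ / _), ← mul_sum]
    rw [h1, h3, htwo]
    ring
  rw [hexp, mul_sum]
  refine (abs_sum_le_sum_abs _ _).trans (sum_le_sum fun i _ => ?_)
  rw [abs_mul, mul_left_comm]
  exact mul_le_mul_of_nonneg_left (hbound i) (abs_nonneg _)
end

section
/- Let M be a real symmetric positive semidefinite 2×2 matrix, for θ ∈ ℝ let e_θ = (cos θ, sin θ), and define g(a,b) = max(a,0)·max(b,0) + min(a,0) + min(b,0). Then the minimum over θ ∈ ℝ of g(e_θᵀ M e_θ, e_{θ+π/2}ᵀ M e_{θ+π/2}) exists and equals det M. -/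
open Matrix

/-- Rotating the standard frame by a suitable angle diagonalizes the symmetric matrix
`!![a, b; b, d]`. -/
theorem exists_angle_offDiag_eq_zero (a b d : ℝ) :
    ∃ θ : ℝ, b * (Real.cos θ ^ 2 - Real.sin θ ^ 2) - (a - d) * (Real.cos θ * Real.sin θ) = 0 := by
  let z : ℂ := ⟨(a - d) / 2, b⟩
  have hcos : ‖z‖ * Real.cos (2 * (z.arg / 2)) = (a - d) / 2 := by
    rw [mul_div_cancel₀ _ two_ne_zero]; exact Complex.norm_mul_cos_arg z
  have hsin : ‖z‖ * Real.sin (2 * (z.arg / 2)) = b := by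
    rw [mul_div_cancel₀ _ two_ne_zero]; exact Complex.norm_mul_sin_arg z
  refine ⟨z.arg / 2, ?_⟩
  rw [Real.cos_two_mul'] at hcos
  rw [Real.sin_two_mul] at hsin
  linear_combination
    2 * Real.cos (z.arg / 2) * Real.sin (z.arg / 2) * hcos -
      (Real.cos (z.arg / 2) ^ 2 - Real.sin (z.arg / 2) ^ 2) * hsin

/-- The product of the diagonal entries of a positive semidefinite `2 × 2` matrix in a rotated
frame exceeds its determinant by the square of the off-diagonal entry in that frame. -/
theorem elliptic_extension_eq_det_add_sq
    (M : Matrix (Fin 2) (Fin 2) ℝ) (hM : M.PosSemidef)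
    (g : ℝ → ℝ → ℝ)
    (hg : ∀ a b : ℝ, g a b = max a 0 * max b 0 + min a 0 + min b 0) (θ : ℝ) :
    g (![Real.cos θ, Real.sin θ] ⬝ᵥ M.mulVec ![Real.cos θ, Real.sin θ])
        (![Real.cos (θ + Real.pi/2), Real.sin (θ + Real.pi/2)] ⬝ᵥ
          M.mulVec ![Real.cos (θ + Real.pi/2), Real.sin (θ + Real.pi/2)]) =
      M.det + (M 0 1 * (Real.cos θ ^ 2 - Real.sin θ ^ 2) -
        (M 0 0 - M 1 1) * (Real.cos θ * Real.sin θ)) ^ 2 := by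
  have hnonneg (v : Fin 2 → ℝ) : 0 ≤ v ⬝ᵥ M.mulVec v := by
    simpa using hM.dotProduct_mulVec_nonneg v
  have hsymm : M 1 0 = M 0 1 := by simpa using hM.isHermitian.apply 0 1
  rw [hg, max_eq_left (hnonneg _), max_eq_left (hnonneg _), min_eq_right (hnonneg _),
    min_eq_right (hnonneg _), Real.cos_add_pi_div_two, Real.sin_add_pi_div_two, det_fin_two]
  simp only [dotProduct, mulVec, Fin.sum_univ_two, cons_val_zero, cons_val_one, hsymm]
  linear_combination (M 0 0 * M 1 1 - M 0 1 ^ 2) *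
    (Real.cos θ ^ 2 + Real.sin θ ^ 2 + 1) * Real.sin_sq_add_cos_sq θ

/-- For a real symmetric positive semidefinite 2×2 matrix `M`,
the minimum over `θ` of
`g(e_θᵀMe_θ, e_{θ+π/2}ᵀMe_{θ+π/2})`, where
`g(a,b) = max(a,0)max(b,0) + min(a,0) + min(b,0)`, exists and equals `det M`. -/
theorem min_elliptic_extension_eq_det
    (M : Matrix (Fin 2) (Fin 2) ℝ) (hM : M.PosSemidef)
    (g : ℝ → ℝ → ℝ)
    (hg : ∀ a b : ℝ, g a b = max a 0 * max b 0 + min a 0 + min b 0) :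
    IsLeast
      (Set.range fun θ : ℝ =>
        g (![Real.cos θ, Real.sin θ] ⬝ᵥ M.mulVec ![Real.cos θ, Real.sin θ])
          (![Real.cos (θ + Real.pi/2), Real.sin (θ + Real.pi/2)] ⬝ᵥ
            M.mulVec ![Real.cos (θ + Real.pi/2), Real.sin (θ + Real.pi/2)]))
      M.det := by
  constructor
  · obtain ⟨θ, hθ⟩ := exists_angle_offDiag_eq_zero (M 0 0) (M 0 1) (M 1 1)
    refine ⟨θ, (elliptic_extension_eq_det_add_sq M hM g hg θ).trans ?_⟩
    rw [hθ, zero_pow two_ne_zero, add_zero]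
  · rintro _ ⟨θ, rfl⟩
    exact (le_add_of_nonneg_right (sq_nonneg _)).trans_eq
      (elliptic_extension_eq_det_add_sq M hM g hg θ).symm
end
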